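/- Let Λ be a lattice in ℝ^n, let Q be a positive definite symmetric bilinear form on ℝ^n that is integral with respect to Λ, fix r ∈ ℝ^n, and let Θ be a theta function for (Q, Q(·,r)). Then for every x ∈ ℝ^n the identity Θ(x) = sup_{a∈ℤ^n}(⟨a,x⟩ − Θ̂(a)) holds and the supremum is attained; that is, Θ is recovered from its Legendre transform restricted to integer slopes. -/

import Mathlib

noncomputable section

/-- Standard inner product on ℝ^n. -/
def dotp {n : ℕ} (a x : Fin n → ℝ) : ℝ := ∑ i, a i * x i

/-- Λ is a (full-rank) lattice in ℝ^n. -/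
def IsLattice {n : ℕ} (Λ : Set (Fin n → ℝ)) : Prop :=
  ∃ e : Module.Basis (Fin n) ℝ (Fin n → ℝ),
    Λ = {x | ∃ c : Fin n → ℤ, x = ∑ i, (c i : ℝ) • e i}

/-- Q is a symmetric bilinear form. -/
def IsSymmBilin {n : ℕ} (Q : (Fin n → ℝ) → (Fin n → ℝ) → ℝ) : Prop :=
  (∀ x, IsLinearMap ℝ (Q x)) ∧ ∀ x y, Q x y = Q y x

/-- Quasi-periodicity condition for (Q, α). -/
def QuasiPeriodic {n : ℕ} (Λ : Set (Fin n → ℝ))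
    (Q : (Fin n → ℝ) → (Fin n → ℝ) → ℝ) (α : (Fin n → ℝ) → ℝ)
    (Θ : (Fin n → ℝ) → ℝ) : Prop :=
  ∀ l ∈ Λ, ∀ x, Θ (x + l) = Θ x + Q l x + (1/2) * Q l l + α l

/-- Θ is regular: locally a max of finitely many affine functions with integral slopes. -/
def RegularFn {n : ℕ} (Θ : (Fin n → ℝ) → ℝ) : Prop :=
  ∀ x : Fin n → ℝ, ∃ U ∈ nhds x, ∃ (k : ℕ) (a : Fin (k+1) → Fin n → ℤ) (c : Fin (k+1) → ℝ),
    ∀ y ∈ U, Θ y = Finset.univ.sup' Finset.univ_nonempty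
      (fun i => dotp (fun j => (a i j : ℝ)) y + c i)

/-- A theta function for (Q, α): convex, regular, quasi-periodic. -/
def IsThetaFn {n : ℕ} (Λ : Set (Fin n → ℝ))
    (Q : (Fin n → ℝ) → (Fin n → ℝ) → ℝ) (α : (Fin n → ℝ) → ℝ)
    (Θ : (Fin n → ℝ) → ℝ) : Prop :=
  ConvexOn ℝ Set.univ Θ ∧ RegularFn Θ ∧ QuasiPeriodic Λ Q α Θ

/-- Q is integral with respect to Λ. -/
def IntegralWrt {n : ℕ} (Q : (Fin n → ℝ) → (Fin n → ℝ) → ℝ) (Λ : Set (Fin n → ℝ)) : Prop :=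
  ∀ l ∈ Λ, ∀ m : Fin n → ℤ, ∃ k : ℤ, Q l (fun i => (m i : ℝ)) = (k : ℝ)

/-- m lies in q(Λ): ⟨m,x⟩ = Q(λ,x) for some λ ∈ Λ and all x. -/
def InQLat {n : ℕ} (Λ : Set (Fin n → ℝ)) (Q : (Fin n → ℝ) → (Fin n → ℝ) → ℝ)
    (m : Fin n → ℝ) : Prop :=
  ∃ l ∈ Λ, ∀ x, dotp m x = Q l x

/-- The generator Θ_b (with v_b passed as `vb`). -/
def ThetaGen {n : ℕ} (Λ : Set (Fin n → ℝ)) (Q : (Fin n → ℝ) → (Fin n → ℝ) → ℝ)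
    (r vb : Fin n → ℝ) (b : Fin n → ℤ) (x : Fin n → ℝ) : ℝ :=
  sSup {t | ∃ l ∈ Λ, t = dotp (fun i => (b i : ℝ)) x + Q l x
      - (1/2) * Q (l + vb - r) (l + vb - r)}

/-- The Legendre transform of Θ. -/
def legendreT {n : ℕ} (Θ : (Fin n → ℝ) → ℝ) (a : Fin n → ℝ) : ℝ :=
  sSup {t | ∃ x, t = dotp a x - Θ x}

/-- The generator Θ_b, with v_b obtained from the duality map v. -/
def thetaGenOf {n : ℕ} (Λ : Set (Fin n → ℝ)) (Q : (Fin n → ℝ) → (Fin n → ℝ) → ℝ)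
    (r : Fin n → ℝ) (v : (Fin n → ℝ) → (Fin n → ℝ)) (b : Fin n → ℤ) :
    (Fin n → ℝ) → ℝ :=
  ThetaGen Λ Q r (v (fun i => (b i : ℝ))) b

/-- φ^b(Θ) = inf_y (Θ(y) − Θ_b(y)). -/
def phiB {n : ℕ} (Λ : Set (Fin n → ℝ)) (Q : (Fin n → ℝ) → (Fin n → ℝ) → ℝ)
    (r : Fin n → ℝ) (v : (Fin n → ℝ) → (Fin n → ℝ)) (b : Fin n → ℤ)
    (Θ : (Fin n → ℝ) → ℝ) : ℝ :=
  sInf {u | ∃ y, u = Θ y - thetaGenOf Λ Q r v b y}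

/-- The coordinate set S ⊂ ℝ^B of tuples (φ^b(Θ))_{b∈B} for theta functions Θ. -/
def thetaCoordSet {n : ℕ} (Λ : Set (Fin n → ℝ)) (Q : (Fin n → ℝ) → (Fin n → ℝ) → ℝ)
    (r : Fin n → ℝ) (v : (Fin n → ℝ) → (Fin n → ℝ)) (B : Finset (Fin n → ℤ)) :
    Set ({b // b ∈ B} → ℝ) :=
  {t | ∃ Θ, IsThetaFn Λ Q (fun x => Q x r) Θ ∧
      ∀ b : {b // b ∈ B}, t b = phiB Λ Q r v b.1 Θ}

/-- Ξ(x) = sup over a ∈ ℤ^n of (⟨a,x⟩ − ½ Q(v_a−r, v_a−r)). -/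
def XiFn {n : ℕ} (Q : (Fin n → ℝ) → (Fin n → ℝ) → ℝ) (v : (Fin n → ℝ) → (Fin n → ℝ))
    (r : Fin n → ℝ) (x : Fin n → ℝ) : ℝ :=
  sSup {t | ∃ a : Fin n → ℤ, t = dotp (fun i => (a i : ℝ)) x
      - (1/2) * Q (v (fun i => (a i : ℝ)) - r) (v (fun i => (a i : ℝ)) - r)}


/-- A continuous function periodic under a lattice is bounded below. -/
theorem periodic_bddBelow {n : ℕ} (Λ : Set (Fin n → ℝ)) (hΛ : IsLattice Λ)
    (f : (Fin n → ℝ) → ℝ) (hf : Continuous f)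
    (hp : ∀ l ∈ Λ, ∀ x, f (x + l) = f x) : ∃ C, ∀ x, C ≤ f x := by
  obtain ⟨e, rfl⟩ := hΛ
  have hg : Continuous (fun c : Fin n → ℝ => f (∑ i, c i • e i)) := by
    apply hf.comp
    fun_prop
  have hK : IsCompact (Set.Icc (0 : Fin n → ℝ) 1) := isCompact_Icc
  obtain ⟨C, hC⟩ := (hK.image hg).bddBelow
  refine ⟨C, fun x => ?_⟩
  have hx : x = (∑ i, Int.fract (e.repr x i) • e i)
      + ∑ i, ((⌊e.repr x i⌋ : ℤ) : ℝ) • e i := by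
    rw [← Finset.sum_add_distrib]
    conv_lhs => rw [← e.sum_repr x]
    refine Finset.sum_congr rfl fun i _ => ?_
    rw [← add_smul, Int.fract_add_floor]
  rw [hx, hp _ ⟨fun i => ⌊e.repr x i⌋, rfl⟩]
  apply hC
  refine ⟨fun i => Int.fract (e.repr x i), ⟨fun i => Int.fract_nonneg _,
    fun i => (Int.fract_lt_one _).le⟩, rfl⟩

/-- `Θ` minus a linear function is bounded below. -/
theorem theta_bdd {n : ℕ} (Λ : Set (Fin n → ℝ)) (hΛ : IsLattice Λ)
    (Q : (Fin n → ℝ) → (Fin n → ℝ) → ℝ) (hQ : IsSymmBilin Q)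
    (hpos : ∀ x : Fin n → ℝ, x ≠ 0 → 0 < Q x x)
    (r : Fin n → ℝ) (Θ : (Fin n → ℝ) → ℝ)
    (hΘ : IsThetaFn Λ Q (fun x => Q x r) Θ) (a : Fin n → ℝ) :
    BddAbove {t | ∃ x, t = dotp a x - Θ x} := by
  obtain ⟨hconv, -, hqp⟩ := hΘ
  obtain ⟨hlin, hsymm⟩ := hQ
  let B : (Fin n → ℝ) →ₗ[ℝ] (Fin n → ℝ) →ₗ[ℝ] ℝ := LinearMap.mk₂ ℝ Q
    (fun x y z => by rw [hsymm, (hlin z).map_add, hsymm z x, hsymm z y])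
    (fun c x y => by rw [hsymm, (hlin y).map_smul, hsymm y x])
    (fun x y z => (hlin x).map_add y z)
    (fun c x y => (hlin x).map_smul c y)
  have hB : ∀ x y, Q x y = B x y := fun x y => rfl
  have hBs : ∀ x y, B x y = B y x := hsymm
  have hΘc : Continuous Θ := by
    rw [← continuousOn_univ]
    exact hconv.continuousOn isOpen_univ
  have hQc : Continuous (fun y => B y y) := by
    have : (fun y => B y y) =
        fun y => ∑ i, y i * B (fun j => if i = j then 1 else 0) y := by
      funext y
      conv_lhs => rw [LinearMap.pi_apply_eq_sum_univ B y]
      simp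
    rw [this]
    refine continuous_finsetSum _ fun i _ => (continuous_apply i).mul ?_
    exact LinearMap.continuous_of_finiteDimensional _
  have hrc : Continuous (fun y => B r y) := LinearMap.continuous_of_finiteDimensional _
  obtain ⟨C, hC⟩ := periodic_bddBelow Λ hΛ (fun y => Θ y - (1/2) * B y y - B r y)
    (by fun_prop) (by
      intro l hl x
      simp only [hqp l hl x, hB, map_add, LinearMap.add_apply]
      rw [hBs x l, hBs l r]
      ring)
  have hinj : Function.Injective B := by
    rw [injective_iff_map_eq_zero]
    intro x hx
    by_contra hne
    have h := hpos x hne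
    rw [hB, hx] at h
    simp at h
  have hsurj : Function.Surjective B :=
    (LinearMap.injective_iff_surjective_of_finrank_eq_finrank
      (Subspace.dual_finrank_eq (K := ℝ) (V := Fin n → ℝ)).symm).1 hinj
  let L : (Fin n → ℝ) →ₗ[ℝ] ℝ := ∑ i, a i • LinearMap.proj i
  have hL : ∀ x, L x = dotp a x := fun x => by simp [L, dotp]
  obtain ⟨v, hv⟩ := hsurj (L - B r)
  refine ⟨(1/2) * B v v - C, ?_⟩
  rintro t ⟨x, rfl⟩
  have h1 := hC x
  have h2 : B v x = dotp a x - B r x := by rw [hv, LinearMap.sub_apply, hL]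
  have h3 : 0 ≤ B (x - v) (x - v) := by
    by_cases h : x - v = 0
    · simp [h]
    · exact (hpos _ h).le
  simp only [map_sub, LinearMap.sub_apply] at h3
  rw [hBs x v] at h3
  linarith

theorem stmt5 {n : ℕ} (Λ : Set (Fin n → ℝ)) (hΛ : IsLattice Λ)
    (Q : (Fin n → ℝ) → (Fin n → ℝ) → ℝ) (hQ : IsSymmBilin Q)
    (hpos : ∀ x : Fin n → ℝ, x ≠ 0 → 0 < Q x x) (hint : IntegralWrt Q Λ)
    (r : Fin n → ℝ) (Θ : (Fin n → ℝ) → ℝ)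
    (hΘ : IsThetaFn Λ Q (fun x => Q x r) Θ) :
    ∀ x : Fin n → ℝ,
      IsGreatest {t | ∃ a : Fin n → ℤ,
        t = dotp (fun i => (a i : ℝ)) x - legendreT Θ (fun i => (a i : ℝ))} (Θ x) := by
  intro x
  refine ⟨?_, ?_⟩
  · obtain ⟨U, hU, k, a, c, h⟩ := hΘ.2.1 x
    obtain ⟨i, -, hi⟩ := Finset.exists_mem_eq_sup' (s := (Finset.univ : Finset (Fin (k+1))))
      Finset.univ_nonempty (fun i => dotp (fun j => (a i j : ℝ)) x + c i)
    have hx := h x (mem_of_mem_nhds hU)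
    rw [hi] at hx
    let L : (Fin n → ℝ) →ₗ[ℝ] ℝ := ∑ j, (a i j : ℝ) • LinearMap.proj j
    have hL : ∀ y, L y = dotp (fun j => (a i j : ℝ)) y := fun y => by simp [L, dotp]
    have hconv : ConvexOn ℝ Set.univ (Θ - (L : (Fin n → ℝ) → ℝ)) :=
      hΘ.1.sub (L.concaveOn convex_univ)
    have hloc : IsLocalMin (Θ - (L : (Fin n → ℝ) → ℝ)) x := by
      filter_upwards [hU] with y hy
      have h1 := h y hy
      have h2 := Finset.le_sup' (fun i => dotp (fun j => (a i j : ℝ)) y + c i)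
        (Finset.mem_univ i)
      simp only [Pi.sub_apply, hL]
      linarith
    have hmin := IsMinOn.of_isLocalMin_of_convex_univ hloc hconv
    refine ⟨a i, ?_⟩
    have hG : IsGreatest {t | ∃ y, t = dotp (fun j => (a i j : ℝ)) y - Θ y}
        (dotp (fun j => (a i j : ℝ)) x - Θ x) := by
      refine ⟨⟨x, rfl⟩, ?_⟩
      rintro t ⟨y, rfl⟩
      have := hmin y
      simp only [Pi.sub_apply, hL] at this
      linarith
    rw [legendreT, hG.csSup_eq]
    ring
  · rintro t ⟨a, rfl⟩
    have := le_csSup (theta_bdd Λ hΛ Q hQ hpos r Θ hΘ (fun i => (a i : ℝ))) ⟨x, rfl⟩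
    rw [legendreT]
    linarith
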